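/- Let g₁ : [0,T] → ℂ be continuously differentiable with g₁(0) = 0, and define for 0 < t ≤ T: I(t) = (2/π) ∫_{∂D₃} ∫₀ᵗ e^{4ik²(t'-t)} ġ₁(t') dt' dk. Then I(t) = -(e^{-iπ/4}/√π) ∫₀ᵗ ġ₁(t')/√(t-t') dt'. -/

import Mathlib

open Filter Topology intervalIntegral
open MeasureTheory

lemma K_norm_exp (b : ℂ) (hb : 0 ≤ b.re) (u : ℝ) :
    ‖Complex.exp (-b * (u:ℂ)^2)‖ ≤ 1 := by
  rw [Complex.norm_exp, Real.exp_le_one_iff]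
  have : (-b * (u:ℂ)^2).re = -(b.re * u^2) := by
    rw [← Complex.ofReal_pow, Complex.re_mul_ofReal]; simp
  rw [this]
  have := mul_nonneg hb (sq_nonneg u)
  linarith

lemma K_tail (b : ℂ) (hb : 0 ≤ b.re) (hb0 : b ≠ 0) (R S : ℝ) (hR : 0 < R) (hRS : R ≤ S) :
    ‖∫ u in R..S, Complex.exp (-b * (u:ℂ)^2)‖ ≤ 1 / (‖b‖ * R) := by
  have hnb : 0 < ‖b‖ := norm_pos_iff.2 hb0
  have hS : 0 < S := hR.trans_le hRS
  have hpos : ∀ u ∈ Set.uIcc R S, 0 < u := by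
    intro u hu
    rw [Set.uIcc_of_le hRS] at hu
    exact hR.trans_le hu.1
  have hd : ∀ u ∈ Set.uIcc R S, HasDerivAt
      (fun u : ℝ => -(Complex.exp (-b * (u:ℂ)^2) / (2 * b * (u:ℂ))))
      (Complex.exp (-b * (u:ℂ)^2) + Complex.exp (-b * (u:ℂ)^2) / (2 * b * (u:ℂ)^2)) u := by
    intro u hu
    have hu0 : (u:ℂ) ≠ 0 := by exact_mod_cast (hpos u hu).ne'
    have h1 : HasDerivAt (fun z : ℂ => -(Complex.exp (-b * z^2) / (2 * b * z)))
      (Complex.exp (-b * (u:ℂ)^2) + Complex.exp (-b * (u:ℂ)^2) / (2 * b * (u:ℂ)^2)) (u:ℂ) := by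
      have e1 : HasDerivAt (fun z : ℂ => Complex.exp (-b * z^2))
          (Complex.exp (-b * (u:ℂ)^2) * (-b * (2 * (u:ℂ)))) (u:ℂ) := by
        have := (((hasDerivAt_id (u:ℂ)).pow 2).const_mul (-b)).cexp
        simpa using this
      have e2 : HasDerivAt (fun z : ℂ => 2 * b * z) (2 * b) (u:ℂ) := by
        simpa using (hasDerivAt_id (u:ℂ)).const_mul (2 * b)
      refine HasDerivAt.congr_deriv (e1.div e2 (by simp [hb0, hu0])).neg ?_
      field_simp
      ring
    exact h1.comp_ofReal
  have hc1 : ContinuousOn (fun u : ℝ => Complex.exp (-b * (u:ℂ)^2)) (Set.uIcc R S) := by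
    fun_prop
  have hc2 : ContinuousOn (fun u : ℝ => Complex.exp (-b * (u:ℂ)^2) / (2 * b * (u:ℂ)^2))
      (Set.uIcc R S) := by
    apply ContinuousOn.div hc1 (by fun_prop)
    intro u hu
    have hu0 : (u:ℂ) ≠ 0 := by exact_mod_cast (hpos u hu).ne'
    simp [hb0, hu0]
  have hF := integral_eq_sub_of_hasDerivAt hd
    (hc1.intervalIntegrable.add hc2.intervalIntegrable)
  rw [integral_add hc1.intervalIntegrable hc2.intervalIntegrable] at hF
  have hgd : ∀ u ∈ Set.uIcc R S, HasDerivAt (fun u : ℝ => -(1 / (2 * ‖b‖ * u)))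
      (1 / (2 * ‖b‖ * u^2)) u := by
    intro u hu
    have hu0 := (hpos u hu).ne'
    have e2 : HasDerivAt (fun z : ℝ => 2 * ‖b‖ * z) (2 * ‖b‖) u := by
      simpa using (hasDerivAt_id u).const_mul (2 * ‖b‖)
    refine HasDerivAt.congr_deriv ((hasDerivAt_const u (1:ℝ)).div e2 (by positivity)).neg ?_
    field_simp
    ring
  have hgc : IntervalIntegrable (fun u : ℝ => 1 / (2 * ‖b‖ * u^2)) volume R S := by
    apply ContinuousOn.intervalIntegrable
    apply ContinuousOn.div (by fun_prop) (by fun_prop)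
    intro u hu
    have hu0 := (hpos u hu).ne'
    positivity
  have hG := integral_eq_sub_of_hasDerivAt hgd hgc
  have hle : ‖∫ u in R..S, Complex.exp (-b * (u:ℂ)^2) / (2 * b * (u:ℂ)^2)‖ ≤
      ∫ u in R..S, 1 / (2 * ‖b‖ * u^2) := by
    apply norm_integral_le_of_norm_le hRS _ hgc
    refine Eventually.of_forall fun u hu => ?_
    have hu0 : 0 < u := hR.trans hu.1
    rw [norm_div]
    have : ‖2 * b * (u:ℂ)^2‖ = 2 * ‖b‖ * u^2 := by simp
    rw [this]
    gcongr
    exact K_norm_exp b hb u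
  rw [hG] at hle
  have hH : ∀ u : ℝ, 0 < u → ‖Complex.exp (-b * (u:ℂ)^2) / (2 * b * (u:ℂ))‖ ≤
      1 / (2 * ‖b‖ * u) := by
    intro u hu0
    rw [norm_div]
    have : ‖2 * b * (u:ℂ)‖ = 2 * ‖b‖ * u := by simp [abs_of_pos hu0]
    rw [this]
    gcongr
    exact K_norm_exp b hb u
  have hHS := hH S hS
  have hHR := hH R hR
  have heq : (∫ u in R..S, Complex.exp (-b * (u:ℂ)^2)) =
     Complex.exp (-b * (R:ℂ)^2) / (2 * b * (R:ℂ)) - Complex.exp (-b * (S:ℂ)^2) / (2 * b * (S:ℂ))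
      - ∫ u in R..S, Complex.exp (-b * (u:ℂ)^2) / (2 * b * (u:ℂ)^2) := by
    linear_combination hF
  rw [heq]
  refine (norm_sub_le _ _).trans ?_
  have := norm_sub_le (Complex.exp (-b * (R:ℂ)^2) / (2 * b * (R:ℂ)))
    (Complex.exp (-b * (S:ℂ)^2) / (2 * b * (S:ℂ)))
  have h2 : 1 / (‖b‖ * R) = 1 / (2 * ‖b‖ * R) + 1 / (2 * ‖b‖ * R) := by field_simp; norm_num
  rw [h2]
  linarith

lemma K_cont (R : ℝ) : Continuous fun b : ℂ => ∫ u in (0:ℝ)..R, Complex.exp (-b * (u:ℂ)^2) := by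
  apply continuous_parametric_intervalIntegral_of_continuous'
  fun_prop

lemma K_pos (b : ℂ) (hb : 0 < b.re) (R : ℝ) (hR : 0 < R) :
    ‖(Real.pi / b : ℂ) ^ (1/2 : ℂ) / 2 - ∫ u in (0:ℝ)..R, Complex.exp (-b * (u:ℂ)^2)‖
      ≤ 1 / (‖b‖ * R) := by
  have hb0 : b ≠ 0 := by rintro rfl; simp at hb
  have hlim := intervalIntegral_tendsto_integral_Ioi 0
    (integrable_cexp_neg_mul_sq hb).integrableOn tendsto_id
  rw [integral_gaussian_complex_Ioi hb] at hlim
  refine le_of_tendsto (hlim.sub_const _).norm ?_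
  filter_upwards [eventually_ge_atTop R] with S hS
  have hi : ∀ a c : ℝ, IntervalIntegrable (fun u : ℝ => Complex.exp (-b * (u:ℂ)^2)) volume a c :=
    fun a c => Continuous.intervalIntegrable (by fun_prop) _ _
  simp only [id]
  rw [integral_interval_sub_left (hi _ _) (hi _ _)]
  exact K_tail b hb.le hb0 R S hR hS

lemma K_lim (b : ℂ) (hb : b.re = 0) (hb' : b.im ≠ 0) (R : ℝ) (hR : 0 < R) :
    ‖(Real.pi / b : ℂ) ^ (1/2 : ℂ) / 2 - ∫ u in (0:ℝ)..R, Complex.exp (-b * (u:ℂ)^2)‖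
      ≤ 1 / (‖b‖ * R) := by
  have hb0 : b ≠ 0 := by rintro rfl; simp at hb'
  have hnb : 0 < ‖b‖ := norm_pos_iff.2 hb0
  have hw : Tendsto (fun ε : ℝ => b + (ε:ℂ)) (𝓝[>] 0) (𝓝 b) := by
    have : Continuous (fun ε : ℝ => b + (ε:ℂ)) := by fun_prop
    have h := this.tendsto 0
    simp only [Complex.ofReal_zero, add_zero] at h
    exact h.mono_left nhdsWithin_le_nhds
  have hsl : (Real.pi / b : ℂ) ∈ Complex.slitPlane := by
    right
    simp [Complex.div_im, hb, hb', hb0, Real.pi_ne_zero]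
  have hc : ContinuousAt (fun b : ℂ => ‖(Real.pi / b : ℂ) ^ (1/2 : ℂ) / 2 -
      ∫ u in (0:ℝ)..R, Complex.exp (-b * (u:ℂ)^2)‖) b := by
    apply ContinuousAt.norm
    apply ContinuousAt.sub _ (K_cont R).continuousAt
    apply ContinuousAt.div_const
    exact ContinuousAt.cpow (continuousAt_const.div continuousAt_id hb0) continuousAt_const hsl
  have hc2 : ContinuousAt (fun b : ℂ => 1 / (‖b‖ * R)) b := by
    apply ContinuousAt.div continuousAt_const (by fun_prop)
    positivity
  refine le_of_tendsto_of_tendsto (hc.tendsto.comp hw) (hc2.tendsto.comp hw) ?_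
  filter_upwards [self_mem_nhdsWithin] with ε hε
  exact K_pos _ (by simpa [hb] using hε) R hR

lemma K_tendsto (b : ℂ) (hb : b.re = 0) (hb' : b.im ≠ 0) :
    Tendsto (fun R : ℝ => ∫ u in (0:ℝ)..R, Complex.exp (-b * (u:ℂ)^2)) atTop
      (𝓝 ((Real.pi / b : ℂ) ^ (1/2 : ℂ) / 2)) := by
  rw [tendsto_iff_norm_sub_tendsto_zero]
  have h0 : Tendsto (fun R : ℝ => (1 / ‖b‖) * R⁻¹) atTop (𝓝 0) := by
    simpa using tendsto_inv_atTop_zero.const_mul (1 / ‖b‖)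
  refine squeeze_zero' (Eventually.of_forall fun _ => norm_nonneg _) ?_ h0
  filter_upwards [eventually_gt_atTop 0] with R hR
  rw [norm_sub_rev]
  refine (K_lim b hb hb' R hR).trans (le_of_eq ?_)
  rw [one_div, mul_inv, one_div]

lemma K_bdd (b : ℂ) (hb : b.re = 0) (hb' : b.im ≠ 0) :
    ∃ M : ℝ, 0 ≤ M ∧ ∀ R : ℝ, 0 ≤ R → ‖∫ u in (0:ℝ)..R, Complex.exp (-b * (u:ℂ)^2)‖ ≤ M := by
  refine ⟨1 + ‖(Real.pi / b : ℂ) ^ (1/2 : ℂ) / 2‖ + 1 / ‖b‖, by positivity, fun R hR => ?_⟩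
  rcases le_total R 1 with h | h
  · have := norm_integral_le_of_norm_le_const (a := 0) (b := R) (C := 1)
      (f := fun u : ℝ => Complex.exp (-b * (u:ℂ)^2)) (fun u _ => K_norm_exp b hb.ge u)
    rw [sub_zero, abs_of_nonneg hR, one_mul] at this
    have h1 : 0 ≤ ‖(Real.pi / b : ℂ) ^ (1/2 : ℂ) / 2‖ := norm_nonneg _
    have h2 : 0 ≤ 1 / ‖b‖ := by positivity
    linarith
  · have hb0 : b ≠ 0 := by rintro rfl; simp at hb'
    have hnb : 0 < ‖b‖ := norm_pos_iff.2 hb0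
    have h1 := K_lim b hb hb' R (by linarith)
    have h2 : 1 / (‖b‖ * R) ≤ 1 / ‖b‖ := by
      apply one_div_le_one_div_of_le hnb
      nlinarith
    have h3 := norm_le_norm_add_norm_sub' (∫ u in (0:ℝ)..R, Complex.exp (-b * (u:ℂ)^2))
      ((Real.pi / b : ℂ) ^ (1/2 : ℂ) / 2)
    rw [norm_sub_rev] at h3
    linarith

lemma K_scale (c : ℂ) (τ R : ℝ) (hτ : 0 < τ) :
    ∫ u in (0:ℝ)..R, Complex.exp (-(c * τ) * (u:ℂ)^2) =
      (∫ u in (0:ℝ)..(Real.sqrt τ * R), Complex.exp (-c * (u:ℂ)^2)) / ((Real.sqrt τ : ℝ) : ℂ) := by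
  have hs : 0 < Real.sqrt τ := Real.sqrt_pos.2 hτ
  have h := integral_comp_mul_left (a := 0) (b := R)
    (fun u : ℝ => Complex.exp (-c * (u:ℂ)^2)) hs.ne'
  rw [mul_zero] at h
  have hsq : ((Real.sqrt τ : ℝ) : ℂ)^2 = (τ : ℂ) := by
    rw [← Complex.ofReal_pow, Real.sq_sqrt hτ.le]
  have e : (fun u : ℝ => Complex.exp (-(c * τ) * (u:ℂ)^2)) =
      fun u : ℝ => Complex.exp (-c * ((Real.sqrt τ * u : ℝ):ℂ)^2) := by
    funext u
    congr 1
    push_cast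
    rw [mul_pow, hsq]; ring
  rw [e, h, Complex.real_smul, Complex.ofReal_inv, div_eq_inv_mul]

lemma half (c : ℂ) (hc : c.re = 0) (hc' : c.im ≠ 0) (t : ℝ) (ht : 0 < t) (g : ℝ → ℂ)
    (hg : Continuous g) :
    Tendsto (fun R : ℝ => ∫ k in (0:ℝ)..R, ∫ s in (0:ℝ)..t,
        Complex.exp (-(c * ((t - s : ℝ) : ℂ)) * (k:ℂ)^2) * g s) atTop
      (𝓝 ((Real.pi / c : ℂ) ^ (1/2 : ℂ) / 2 *
        ∫ s in (0:ℝ)..t, g s / ((Real.sqrt (t - s) : ℝ) : ℂ))) := by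
  have hsw : ∀ R : ℝ, (∫ k in (0:ℝ)..R, ∫ s in (0:ℝ)..t,
        Complex.exp (-(c * ((t - s : ℝ) : ℂ)) * (k:ℂ)^2) * g s) =
      ∫ s in (0:ℝ)..t, (∫ k in (0:ℝ)..R,
        Complex.exp (-(c * ((t - s : ℝ) : ℂ)) * (k:ℂ)^2)) * g s := by
    intro R
    rw [intervalIntegral_intervalIntegral_swap]
    · simp_rw [intervalIntegral.integral_mul_const]
    · have hcont : Continuous (Function.uncurry fun k s : ℝ =>
          Complex.exp (-(c * ((t - s : ℝ) : ℂ)) * (k:ℂ)^2) * g s) := by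
        unfold Function.uncurry
        fun_prop
      refine IntegrableOn.mono_set (t := Set.uIcc 0 R ×ˢ Set.uIcc 0 t) ?_
        (Set.prod_mono Set.uIoc_subset_uIcc Set.uIoc_subset_uIcc)
      exact hcont.continuousOn.integrableOn_compact (isCompact_uIcc.prod isCompact_uIcc)
  simp_rw [hsw]
  rw [← intervalIntegral.integral_const_mul]
  obtain ⟨M, hM0, hM⟩ := K_bdd c hc hc'
  apply intervalIntegral.tendsto_integral_filter_of_dominated_convergence
    (fun s => (t - s) ^ (-(1/2) : ℝ) * (M * ‖g s‖))
  · refine Eventually.of_forall fun R => Continuous.aestronglyMeasurable ?_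
    refine Continuous.mul ?_ hg
    exact (K_cont R).comp (f := fun s : ℝ => c * ((t - s : ℝ) : ℂ)) (by fun_prop)
  · filter_upwards [eventually_ge_atTop 0] with R hR
    have hne : ∀ᵐ s : ℝ, s ≠ t := by simp [ae_iff]
    filter_upwards [hne] with s hst hs
    rw [Set.uIoc_of_le ht.le] at hs
    have hτ : 0 < t - s := sub_pos.2 (lt_of_le_of_ne hs.2 hst)
    rw [K_scale c _ R hτ, norm_mul, norm_div, Complex.norm_real, Real.norm_of_nonneg (Real.sqrt_nonneg _),
      Real.rpow_neg hτ.le, ← Real.sqrt_eq_rpow, div_eq_inv_mul, mul_assoc]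
    gcongr
    exact hM _ (by positivity)
  · apply IntervalIntegrable.mul_continuousOn
    · have := (intervalIntegrable_rpow' (a := 0) (b := t) (r := -(1/2)) (by norm_num)).comp_sub_left t
      simpa using this.symm
    · fun_prop
  · have hne : ∀ᵐ s : ℝ, s ≠ t := by simp [ae_iff]
    filter_upwards [hne] with s hst hs
    rw [Set.uIoc_of_le ht.le] at hs
    have hτ : 0 < t - s := sub_pos.2 (lt_of_le_of_ne hs.2 hst)
    simp_rw [K_scale c _ _ hτ]
    have h1 := (K_tendsto c hc hc').comp
      (tendsto_id.const_mul_atTop (Real.sqrt_pos.2 hτ))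
    have h2 := (h1.div_const ((Real.sqrt (t - s) : ℝ) : ℂ)).mul_const (g s)
    have e : (Real.pi / c : ℂ) ^ (1/2 : ℂ) / 2 * (g s / ((Real.sqrt (t - s) : ℝ) : ℂ)) =
        (Real.pi / c : ℂ) ^ (1/2 : ℂ) / 2 / ((Real.sqrt (t - s) : ℝ) : ℂ) * g s := by ring
    rw [e]
    exact h2

lemma root_val (c w : ℂ) (hw : 0 < w.re) (h : (Real.pi / c : ℂ) = w ^ 2) :
    (Real.pi / c : ℂ) ^ (1/2 : ℂ) = w := by
  rw [h, one_div, Complex.sq_cpow_two_inv hw]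

theorem stmt15 (T t : ℝ) (ht : 0 < t) (htT : t ≤ T) (g₁ g₁' : ℝ → ℂ)
    (hder : ∀ s : ℝ, HasDerivAt g₁ (g₁' s) s) (hcont : Continuous g₁') (h0 : g₁ 0 = 0)
    (inn : ℂ → ℂ)
    (hinn : ∀ k : ℂ, inn k =
      ∫ s in (0:ℝ)..t, Complex.exp (4 * Complex.I * k ^ 2 * ((s : ℂ) - t)) * g₁' s) :
    Tendsto (fun R : ℝ => ((2 / Real.pi : ℝ) : ℂ) *
        (Complex.I * (∫ s in (0:ℝ)..R, inn (-(Complex.I) * s))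
          - ∫ r in (0:ℝ)..R, inn (-(r : ℂ))))
      atTop
      (𝓝 (-(Complex.exp (-(Complex.I) * Real.pi / 4) / ((Real.sqrt Real.pi : ℝ) : ℂ)) *
        ∫ s in (0:ℝ)..t, g₁' s / ((Real.sqrt (t - s) : ℝ) : ℂ))) := by
  have hA := half (-(4 * Complex.I)) (by simp) (by simp) t ht g₁' hcont
  have hB := half (4 * Complex.I) (by simp) (by simp) t ht g₁' hcont
  have hfin := ((hA.const_mul Complex.I).sub hB).const_mul ((2 / Real.pi : ℝ) : ℂ)
  have hI : Complex.I ^ 2 = -1 := Complex.I_sq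
  have hpi : ((Real.sqrt Real.pi : ℝ) : ℂ) ^ 2 = Real.pi := by
    rw [← Complex.ofReal_pow, Real.sq_sqrt Real.pi_pos.le]
  have hpi0 : ((Real.sqrt Real.pi : ℝ) : ℂ) ≠ 0 := by
    exact_mod_cast (Real.sqrt_pos.2 Real.pi_pos).ne'
  have h2 : ((Real.sqrt 2 : ℝ) : ℂ) ^ 2 = 2 := by
    rw [← Complex.ofReal_pow, Real.sq_sqrt (by norm_num)]; simp
  have hE : Complex.exp (-(Complex.I) * Real.pi / 4) =
      ((Real.sqrt 2 / 2 : ℝ) : ℂ) * (1 - Complex.I) := by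
    have : -(Complex.I) * Real.pi / 4 = ((-(Real.pi / 4) : ℝ) : ℂ) * Complex.I := by
      push_cast; ring
    rw [this, Complex.exp_mul_I, ← Complex.ofReal_cos, ← Complex.ofReal_sin, Real.cos_neg,
      Real.sin_neg, Real.cos_pi_div_four, Real.sin_pi_div_four]
    push_cast; ring
  have hs2 : 0 < Real.sqrt Real.pi * Real.sqrt 2 := by
    have := Real.pi_pos
    positivity
  have r1 := root_val (-(4 * Complex.I))
    (((Real.sqrt Real.pi * Real.sqrt 2 / 4 : ℝ) : ℂ) * (1 + Complex.I))
    (by rw [Complex.re_ofReal_mul]; simp; simpa using hs2)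
    (by
      rw [div_eq_iff (by simp)]
      push_cast
      rw [mul_pow, div_pow, mul_pow, hpi, h2]
      linear_combination ((Real.pi : ℂ) * (1 + Complex.I / 2)) * hI)
  have r2 := root_val (4 * Complex.I)
    (((Real.sqrt Real.pi * Real.sqrt 2 / 4 : ℝ) : ℂ) * (1 - Complex.I))
    (by rw [Complex.re_ofReal_mul]; simp; simpa using hs2)
    (by
      rw [div_eq_iff (by simp)]
      push_cast
      rw [mul_pow, div_pow, mul_pow, hpi, h2]
      linear_combination ((Real.pi : ℂ) * (1 - Complex.I / 2)) * hI)
  rw [r1, r2] at hfin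
  convert hfin using 2
  · rename_i R
    congr 2
    · congr 1
      apply intervalIntegral.integral_congr
      intro k _
      simp only [hinn]
      apply intervalIntegral.integral_congr
      intro s _
      simp only
      congr 2
      push_cast
      linear_combination (4 * Complex.I * k^2 * (s - t)) * hI
    · apply intervalIntegral.integral_congr
      intro k _
      simp only [hinn]
      apply intervalIntegral.integral_congr
      intro s _
      simp only
      congr 2
      push_cast
      ring
  · rw [hE]
    have hpc : ((2 / Real.pi : ℝ) : ℂ) = 2 / ((Real.sqrt Real.pi : ℝ) : ℂ) ^ 2 := by
      rw [hpi]; push_cast; rfl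
    rw [hpc]
    push_cast
    generalize (∫ s in (0:ℝ)..t, g₁' s / ((Real.sqrt (t - s) : ℝ) : ℂ)) = J
    field_simp
    linear_combination (-2 * J) * hI
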